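/- For every n ≥ 2, the number of quasi-Stirling permutations of the multiset [n,n] that avoid both patterns 312 and 321 equals 4 · 3^{n−2}. -/

import Mathlib

/-- `π : Fin (2*n) → Fin n` encodes a permutation of the multiset
`{1,1,2,2,…,n,n}`: every value appears exactly twice. -/
def IsMultisetPerm (n : ℕ) (π : Fin (2 * n) → Fin n) : Prop :=
  ∀ v : Fin n, Nat.card {i : Fin (2 * n) // π i = v} = 2

/-- `π` avoids the pattern 1212. -/
def Avoids1212 (n : ℕ) (π : Fin (2 * n) → Fin n) : Prop :=
  ¬ ∃ i j k l : Fin (2 * n), i < j ∧ j < k ∧ k < l ∧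
      π i = π k ∧ π j = π l ∧ π i < π j

/-- `π` avoids the pattern 2121. -/
def Avoids2121 (n : ℕ) (π : Fin (2 * n) → Fin n) : Prop :=
  ¬ ∃ i j k l : Fin (2 * n), i < j ∧ j < k ∧ k < l ∧
      π i = π k ∧ π j = π l ∧ π j < π i

/-- A quasi-Stirling permutation: a permutation of the multiset `[n,n]`
avoiding both 1212 and 2121. -/
def IsQuasiStirling (n : ℕ) (π : Fin (2 * n) → Fin n) : Prop :=
  IsMultisetPerm n π ∧ Avoids1212 n π ∧ Avoids2121 n π

/-- `π` contains the length-3 pattern `σ` (with distinct entries):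
there are positions `i₁ < i₂ < i₃` whose values are in the same relative
order as `σ`. -/
def Contains3 (n : ℕ) (σ : Fin 3 → ℕ) (π : Fin (2 * n) → Fin n) : Prop :=
  ∃ f : Fin 3 → Fin (2 * n), StrictMono f ∧
    ∀ a b : Fin 3, π (f a) < π (f b) ↔ σ a < σ b

/-- `π` avoids the length-3 pattern `σ`. -/
def Avoids3 (n : ℕ) (σ : Fin 3 → ℕ) (π : Fin (2 * n) → Fin n) : Prop :=
  ¬ Contains3 n σ π

/-- The reversal of `w` is a quasi-Stirling permutation of `{0, 0, …, n - 1, n - 1}`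
avoiding 312 and 321. -/
structure GoodWord (n : ℕ) (w : List ℕ) : Prop where
  length_eq : w.length = 2 * n
  lt : ∀ v ∈ w, v < n
  count_eq : ∀ v < n, w.count v = 2
  noncrossing : ∀ a b, a ≠ b → ¬ [a, b, a, b].Sublist w
  layered : ∀ a b c, a < c → b < c → a ≠ b → ¬ [a, b, c].Sublist w

namespace GoodWord

theorem of_insert {n : ℕ} {u w : List ℕ} (hw : GoodWord n w) (hu : u.Perm (n :: n :: w))
    (hf : u.filter (· ≠ n) = w)
    (h₁ : ∀ a, a ≠ n → ¬ [a, n, a, n].Sublist u) (h₂ : ∀ a, a ≠ n → ¬ [n, a, n, a].Sublist u)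
    (h₃ : ∀ a b, a < n → b < n → a ≠ b → ¬ [a, b, n].Sublist u) : GoodWord (n + 1) u where
  length_eq := by have := hw.length_eq; have := hu.length_eq; simp at this; omega
  lt v hv := by have := hw.lt v; have := hu.mem_iff.1 hv; grind
  count_eq v hv := by
    have h := hw.count_eq v
    have h' : n ∉ w := fun h => (hw.lt n h).false
    rw [hu.count_eq]
    grind
  noncrossing a b hab hs := by
    by_cases ha : a = n
    · subst ha; exact h₂ b hab.symm hs
    by_cases hb : b = n
    · subst hb; exact h₁ a hab hs
    have := hs.filter (· ≠ n)
    rw [hf] at this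
    exact hw.noncrossing a b hab (by simpa [ha, hb] using this)
  layered a b c hac hbc hab hs := by
    have hc : c < n + 1 := by
      have := hw.lt c
      have := hu.mem_iff.1 (hs.subset (by simp : c ∈ [a, b, c]))
      grind
    by_cases hcn : c = n
    · subst hcn; exact h₃ a b hac hbc hab hs
    have := hs.filter (· ≠ n)
    rw [hf] at this
    have ha : a ≠ n := by omega
    have hb : b ≠ n := by omega
    exact hw.layered a b c hac hbc hab (by simpa [ha, hb, hcn] using this)

theorem notMem {n : ℕ} {w : List ℕ} (hw : GoodWord n w) : n ∉ w := fun h => (hw.lt n h).false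

theorem filter_ne {n : ℕ} {w : List ℕ} (hw : GoodWord n w) : w.filter (· ≠ n) = w :=
  List.filter_eq_self.2 fun v hv => by simpa using (hw.lt v hv).ne

theorem of_remove {n : ℕ} {u w : List ℕ} (hu : GoodWord (n + 1) u) (hp : u.Perm (n :: n :: w))
    (hs : w.Sublist u) : GoodWord n w := by
  have hn : n ∉ w := by
    have := hu.count_eq n (by omega)
    rw [hp.count_eq] at this
    simpa [List.count_eq_zero] using this
  refine ⟨?_, ?_, ?_, fun a b hab h => hu.noncrossing a b hab (h.trans hs),
    fun a b c hac hbc hab h => hu.layered a b c hac hbc hab (h.trans hs)⟩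
  · have := hu.length_eq; have := hp.length_eq; simp at this; omega
  · intro v hv
    have := hu.lt v (hs.subset hv)
    grind
  · intro v hv
    have := hu.count_eq v (by omega)
    rw [hp.count_eq] at this
    grind

theorem top_top {n : ℕ} {w : List ℕ} (hw : GoodWord n w) : GoodWord (n + 1) (n :: n :: w) := by
  have hn := hw.notMem
  have hf := hw.filter_ne
  apply hw.of_insert (.refl _) (by simpa using hf) <;> intros <;> intro hs
  all_goals grind [List.cons_sublist_cons', List.Sublist.subset]

theorem cons_top_top {n x : ℕ} {t : List ℕ} (hw : GoodWord n (x :: t)) :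
    GoodWord (n + 1) (x :: n :: n :: t) := by
  have hn := hw.notMem
  have hf := hw.filter_ne
  apply hw.of_insert (by grind) (by grind) <;> intros <;> intro hs
  all_goals grind [List.cons_sublist_cons', List.Sublist.subset]

theorem pair_top_top {n x : ℕ} {t : List ℕ} (hw : GoodWord n (x :: x :: t)) :
    GoodWord (n + 1) (x :: x :: n :: n :: t) := by
  have hn := hw.notMem
  have hf := hw.filter_ne
  apply hw.of_insert (by grind) (by grind) <;> intros <;> intro hs
  all_goals grind [List.cons_sublist_cons', List.Sublist.subset]

theorem top_pair_top {n x : ℕ} {t : List ℕ} (hw : GoodWord n (x :: x :: t)) :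
    GoodWord (n + 1) (n :: x :: x :: n :: t) := by
  have hn := hw.notMem
  have hf := hw.filter_ne
  have hx : x ∉ t := by
    have := hw.count_eq x (hw.lt x (by simp))
    simpa [List.count_eq_zero] using this
  apply hw.of_insert (by grind) (by grind) <;> intros <;> intro hs
  all_goals grind [List.cons_sublist_cons', List.Sublist.subset]

theorem succ_cases {n : ℕ} {u : List ℕ} (hu : GoodWord (n + 1) u) :
    (∃ w, GoodWord n w ∧ u = n :: n :: w) ∨
    (∃ x t, GoodWord n (x :: t) ∧ u = x :: n :: n :: t) ∨
    (∃ x t, GoodWord n (x :: x :: t) ∧ u = x :: x :: n :: n :: t) ∨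
    (∃ x t, GoodWord n (x :: x :: t) ∧ u = n :: x :: x :: n :: t) := by
  have hc := hu.count_eq n (by omega)
  obtain ⟨p, s, rfl, hp⟩ := List.eq_append_cons_of_mem
    (List.count_pos_iff.1 (by omega : 0 < u.count n))
  have hs : s.count n = 1 := by
    simpa [List.count_eq_zero.2 hp] using hc
  obtain ⟨q, t, rfl, hq⟩ := List.eq_append_cons_of_mem
    (List.count_pos_iff.1 (by omega : 0 < s.count n))
  have hw : GoodWord n (p ++ q ++ t) := by
    refine hu.of_remove (by grind) ?_
    rw [List.append_assoc]
    exact (List.Sublist.refl p).append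
      (((List.Sublist.refl q).append (List.sublist_cons_self n t)).cons n)
  have heq : ∀ a b, [a, b].Sublist (p ++ q) → a = b := by
    intro a b hab
    by_contra hne
    have hl : ∀ v ∈ [a, b], v < n := fun v hv =>
      hw.lt v (List.mem_append_left _ (hab.subset hv))
    refine hu.layered a b n (hl a (by simp)) (hl b (by simp)) hne ?_
    have h : [a, b, n].Sublist (p ++ q ++ n :: t) := by
      simpa using hab.append (List.Sublist.cons_cons n (List.nil_sublist t))
    refine h.trans ?_
    rw [List.append_assoc]
    exact (List.Sublist.refl p).append (List.sublist_cons_self n _)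
  have hcount : ∀ v ∈ p ++ q, (p ++ q).count v + t.count v = 2 := by
    intro v hv
    rw [← List.count_append]
    exact hw.count_eq v (hw.lt v (List.mem_append_left _ hv))
  have hx : ∀ x, x ∈ p → x ∈ q → False := by
    intro x hxp hxq
    refine hu.noncrossing x n (by grind) ?_
    have h₁ : [x].Sublist p := by simpa using hxp
    have h₂ : [x].Sublist q := by simpa using hxq
    exact h₁.append (List.Sublist.cons_cons n
      (h₂.append (List.Sublist.cons_cons n (List.nil_sublist t))))
  match p, q with
  | [], [] => exact .inl ⟨t, hw, rfl⟩
  | [], [x] =>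
    have hxt : x ∈ t := by
      have := hcount x (by simp)
      exact List.count_pos_iff.1 (by simp at this; omega)
    refine (hu.noncrossing n x (by grind) ?_).elim
    simpa using hxt
  | [], [x, y] =>
    obtain rfl := heq x y (by simp)
    exact .inr (.inr (.inr ⟨x, t, hw, rfl⟩))
  | [], x :: y :: z :: r =>
    obtain rfl := heq x y (by simp)
    obtain rfl := heq x z (by simp)
    have := hcount x (by simp)
    simp at this
    omega
  | [x], [] => exact .inr (.inl ⟨x, t, hw, rfl⟩)
  | [x, y], [] =>
    obtain rfl := heq x y (by simp)
    exact .inr (.inr (.inl ⟨x, t, hw, rfl⟩))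
  | x :: y :: z :: r, q =>
    obtain rfl := heq x y (by simp)
    obtain rfl := heq x z (by simp)
    have := hcount x (by simp)
    simp at this
    omega
  | x :: r, y :: r' =>
    obtain rfl := heq x y (by simp)
    exact (hx x (by simp) (by simp)).elim

theorem one_iff {w : List ℕ} : GoodWord 1 w ↔ w = [0, 0] := by
  constructor
  · intro h
    refine List.eq_replicate_iff.2 ⟨h.length_eq, fun v hv => ?_⟩
    have := h.lt v hv
    omega
  · rintro rfl
    refine ⟨rfl, by simp, fun v hv => ?_, ?_, ?_⟩
    · obtain rfl : v = 0 := by omega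
      rfl
    · intro a b hab h
      exact absurd h.length_le (by simp)
    · intro a b c _ _ _ h
      exact absurd h.length_le (by simp)

end GoodWord

/-- Words whose first two letters agree. -/
def doubleHead : Set (List ℕ) := {w | ∃ x t, w = x :: x :: t}

/-- Insert two copies of `n` after the first letter. -/
def insertAfterOne (n : ℕ) : List ℕ → List ℕ
  | [] => []
  | x :: t => x :: n :: n :: t

/-- Insert two copies of `n` after the second letter. -/
def insertAfterTwo (n : ℕ) : List ℕ → List ℕ
  | x :: y :: t => x :: y :: n :: n :: t
  | w => w

/-- Insert one copy of `n` before the first letter and one after the second. -/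
def insertAroundTwo (n : ℕ) : List ℕ → List ℕ
  | x :: y :: t => n :: x :: y :: n :: t
  | w => w

theorem setOf_goodWord_succ_inter_doubleHead (n : ℕ) :
    {w | GoodWord (n + 1) w} ∩ doubleHead =
      (fun w => n :: n :: w) '' {w | GoodWord n w} ∪
        insertAfterTwo n '' ({w | GoodWord n w} ∩ doubleHead) := by
  ext u
  constructor
  · rintro ⟨hu, y, s, rfl⟩
    rcases GoodWord.succ_cases hu with ⟨w, hw, h⟩ | ⟨x, t, hw, h⟩ | ⟨x, t, hw, h⟩ | ⟨x, t, hw, h⟩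
    · exact .inl ⟨w, hw, h.symm⟩
    · have := hw.lt x (by simp)
      grind
    · exact .inr ⟨_, ⟨hw, x, t, rfl⟩, h.symm⟩
    · have := hw.lt x (by simp)
      grind
  · rintro (⟨w, hw, rfl⟩ | ⟨_, ⟨hw, x, t, rfl⟩, rfl⟩)
    · exact ⟨hw.top_top, n, w, rfl⟩
    · exact ⟨hw.pair_top_top, x, _, rfl⟩

theorem setOf_goodWord_succ_diff_doubleHead {n : ℕ} (hn : n ≠ 0) :
    {w | GoodWord (n + 1) w} \ doubleHead =
      insertAfterOne n '' {w | GoodWord n w} ∪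
        insertAroundTwo n '' ({w | GoodWord n w} ∩ doubleHead) := by
  ext u
  constructor
  · rintro ⟨hu, hd⟩
    rcases GoodWord.succ_cases hu with ⟨w, hw, h⟩ | ⟨x, t, hw, h⟩ | ⟨x, t, hw, h⟩ | ⟨x, t, hw, h⟩
    · exact (hd ⟨n, w, h⟩).elim
    · exact .inl ⟨_, hw, h.symm⟩
    · exact (hd ⟨x, _, h⟩).elim
    · exact .inr ⟨_, ⟨hw, x, t, rfl⟩, h.symm⟩
  · rintro (⟨w, hw, rfl⟩ | ⟨_, ⟨hw, x, t, rfl⟩, rfl⟩)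
    · match w, hw with
      | [], hw => exact absurd hw.length_eq (by simpa using hn)
      | x :: t, hw =>
        refine ⟨GoodWord.cons_top_top hw, ?_⟩
        rintro ⟨y, s, h⟩
        have := GoodWord.lt hw x (by simp)
        grind [insertAfterOne]
    · refine ⟨hw.top_pair_top, ?_⟩
      rintro ⟨y, s, h⟩
      have := hw.lt x (by simp)
      grind [insertAroundTwo]

theorem injective_insertAfterOne (n : ℕ) : Function.Injective (insertAfterOne n) := by
  rintro (_ | ⟨x, s⟩) (_ | ⟨y, t⟩) h <;> simp_all [insertAfterOne]

theorem injOn_insertAfterTwo (n : ℕ) : Set.InjOn (insertAfterTwo n) doubleHead := by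
  rintro _ ⟨x, s, rfl⟩ _ ⟨y, t, rfl⟩ h
  simpa [insertAfterTwo] using h

theorem injOn_insertAroundTwo (n : ℕ) : Set.InjOn (insertAroundTwo n) doubleHead := by
  rintro _ ⟨x, s, rfl⟩ _ ⟨y, t, rfl⟩ h
  simpa [insertAroundTwo] using h

theorem encard_goodWord_succ_inter_doubleHead (n : ℕ) :
    ({w | GoodWord (n + 1) w} ∩ doubleHead).encard =
      {w | GoodWord n w}.encard + ({w | GoodWord n w} ∩ doubleHead).encard := by
  rw [setOf_goodWord_succ_inter_doubleHead, Set.encard_union_eq,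
    Set.InjOn.encard_image (by intro; simp),
    ((injOn_insertAfterTwo n).mono Set.inter_subset_right).encard_image]
  rw [Set.disjoint_left]
  rintro _ ⟨w, hw, rfl⟩ ⟨_, ⟨hw', x, t, rfl⟩, h⟩
  have := GoodWord.lt hw' x (by simp)
  grind [insertAfterTwo]

theorem encard_goodWord_succ_diff_doubleHead {n : ℕ} (hn : n ≠ 0) :
    ({w | GoodWord (n + 1) w} \ doubleHead).encard =
      {w | GoodWord n w}.encard + ({w | GoodWord n w} ∩ doubleHead).encard := by
  rw [setOf_goodWord_succ_diff_doubleHead hn, Set.encard_union_eq,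
    (injective_insertAfterOne n).encard_image,
    ((injOn_insertAroundTwo n).mono Set.inter_subset_right).encard_image]
  rw [Set.disjoint_left]
  rintro _ ⟨w, hw, rfl⟩ ⟨_, ⟨hw', x, t, rfl⟩, h⟩
  match w, hw with
  | [], _ => simp [insertAfterOne, insertAroundTwo] at h
  | y :: s, hw =>
    have := GoodWord.lt hw y (by simp)
    grind [insertAfterOne, insertAroundTwo]

theorem encard_goodWord_succ {n : ℕ} (hn : n ≠ 0) :
    {w | GoodWord (n + 1) w}.encard =
      2 * ({w | GoodWord (n + 1) w} ∩ doubleHead).encard := by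
  rw [← Set.encard_sdiff_add_encard_inter _ doubleHead, encard_goodWord_succ_diff_doubleHead hn,
    ← encard_goodWord_succ_inter_doubleHead, two_mul]

theorem encard_goodWord_add_two_inter_doubleHead (m : ℕ) :
    ({w | GoodWord (m + 2) w} ∩ doubleHead).encard = 2 * 3 ^ m := by
  induction m with
  | zero =>
    have h : {w | GoodWord 1 w} = {[0, 0]} := by ext; exact GoodWord.one_iff
    have h' : ({[0, 0]} : Set (List ℕ)) ∩ doubleHead = {[0, 0]} :=
      Set.inter_eq_left.2 (by rintro _ rfl; exact ⟨0, [], rfl⟩)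
    rw [encard_goodWord_succ_inter_doubleHead, h, h']
    simp [one_add_one_eq_two]
  | succ m ih =>
    rw [encard_goodWord_succ_inter_doubleHead, encard_goodWord_succ (by omega), ih, pow_succ]
    ring

theorem encard_goodWord_add_two (m : ℕ) : {w | GoodWord (m + 2) w}.encard = 4 * 3 ^ m := by
  rw [encard_goodWord_succ (by omega), encard_goodWord_add_two_inter_doubleHead]
  ring

/-- The values of `π`, read from right to left. -/
def reverseWord {n : ℕ} (π : Fin (2 * n) → Fin n) : List ℕ :=
  (List.ofFn fun i => (π i : ℕ)).reverse

theorem sublist_ofFn_iff {α : Type*} {m : ℕ} {g : Fin m → α} {l : List α} :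
    l.Sublist (List.ofFn g) ↔
      ∃ f : Fin l.length → Fin m, StrictMono f ∧ ∀ i, g (f i) = l.get i := by
  rw [List.sublist_iff_exists_fin_orderEmbedding_get_eq]
  constructor
  · rintro ⟨f, hf⟩
    exact ⟨fun i => Fin.cast (by simp) (f i), fun i j h => f.strictMono h,
      fun i => by rw [hf, List.get_ofFn]⟩
  · rintro ⟨f, hf, h⟩
    refine ⟨OrderEmbedding.ofStrictMono (fun i => Fin.cast (by simp) (f i)) fun i j hij => hf hij,
      fun i => ?_⟩
    rw [← h, List.get_ofFn]
    rfl

theorem sublist_ofFn_three_iff {α : Type*} {m : ℕ} {g : Fin m → α} {a b c : α} :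
    [a, b, c].Sublist (List.ofFn g) ↔
      ∃ i j k, i < j ∧ j < k ∧ g i = a ∧ g j = b ∧ g k = c := by
  rw [sublist_ofFn_iff]
  constructor
  · rintro ⟨f, hf, h⟩
    exact ⟨f 0, f 1, f 2, hf (Nat.lt_succ_self _), hf (Nat.lt_succ_self _), h 0, h 1, h 2⟩
  · rintro ⟨i, j, k, hij, hjk, rfl, rfl, rfl⟩
    refine ⟨![i, j, k], Fin.strictMono_iff_lt_succ.2 fun x => ?_, fun x => ?_⟩
    · fin_cases x <;> assumption
    · fin_cases x <;> rfl

theorem sublist_ofFn_four_iff {α : Type*} {m : ℕ} {g : Fin m → α} {a b c d : α} :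
    [a, b, c, d].Sublist (List.ofFn g) ↔
      ∃ i j k l, i < j ∧ j < k ∧ k < l ∧ g i = a ∧ g j = b ∧ g k = c ∧ g l = d := by
  rw [sublist_ofFn_iff]
  constructor
  · rintro ⟨f, hf, h⟩
    exact ⟨f 0, f 1, f 2, f 3, hf (Nat.lt_succ_self _), hf (Nat.lt_succ_self _), hf (Nat.lt_succ_self _),
      h 0, h 1, h 2, h 3⟩
  · rintro ⟨i, j, k, l, hij, hjk, hkl, rfl, rfl, rfl, rfl⟩
    refine ⟨![i, j, k, l], Fin.strictMono_iff_lt_succ.2 fun x => ?_, fun x => ?_⟩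
    · fin_cases x <;> assumption
    · fin_cases x <;> rfl

theorem count_ofFn {α : Type*} [DecidableEq α] {m : ℕ} (g : Fin m → α) (a : α) :
    (List.ofFn g).count a = Nat.card {i // g i = a} := by
  have h := Fin.card_filter_univ_eq_vector_get_eq_count a ⟨List.ofFn g, List.length_ofFn⟩
  simp only [List.Vector.get, List.Vector.toList] at h
  rw [Nat.card_eq_fintype_card, Fintype.card_subtype, ← h]
  simp

theorem reverseWord_injective (n : ℕ) :
    Function.Injective (reverseWord : (Fin (2 * n) → Fin n) → List ℕ) := by
  intro π ρ h
  funext i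
  exact Fin.ext (congrFun (List.ofFn_injective (List.reverse_injective h)) i)

theorem three_sublist_reverseWord_iff {n : ℕ} {π : Fin (2 * n) → Fin n} {a b c : ℕ} :
    [a, b, c].Sublist (reverseWord π) ↔
      ∃ i j k, i < j ∧ j < k ∧ (π i : ℕ) = c ∧ (π j : ℕ) = b ∧ (π k : ℕ) = a := by
  rw [← sublist_ofFn_three_iff, reverseWord, ← List.reverse_sublist]
  simp

theorem four_sublist_reverseWord_iff {n : ℕ} {π : Fin (2 * n) → Fin n} {a b c d : ℕ} :
    [a, b, c, d].Sublist (reverseWord π) ↔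
      ∃ i j k l, i < j ∧ j < k ∧ k < l ∧
        (π i : ℕ) = d ∧ (π j : ℕ) = c ∧ (π k : ℕ) = b ∧ (π l : ℕ) = a := by
  rw [← sublist_ofFn_four_iff, reverseWord, ← List.reverse_sublist]
  simp

theorem contains3_iff {n : ℕ} {σ : Fin 3 → ℕ} {π : Fin (2 * n) → Fin n} :
    Contains3 n σ π ↔ ∃ i j k, i < j ∧ j < k ∧
      ∀ a b : Fin 3, π (![i, j, k] a) < π (![i, j, k] b) ↔ σ a < σ b := by
  constructor
  · rintro ⟨f, hf, h⟩
    refine ⟨f 0, f 1, f 2, hf (by simp), hf (by simp), ?_⟩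
    have hf' : ![f 0, f 1, f 2] = f := by
      funext x
      fin_cases x <;> rfl
    rwa [hf']
  · rintro ⟨i, j, k, hij, hjk, h⟩
    refine ⟨![i, j, k], Fin.strictMono_iff_lt_succ.2 fun x => ?_, h⟩
    fin_cases x <;> assumption

theorem contains3_312_iff {n : ℕ} {π : Fin (2 * n) → Fin n} :
    Contains3 n ![3, 1, 2] π ↔ ∃ i j k, i < j ∧ j < k ∧ π j < π k ∧ π k < π i := by
  simp only [contains3_iff, Fin.forall_fin_succ, Fin.lt_def]
  simp
  grind

theorem contains3_321_iff {n : ℕ} {π : Fin (2 * n) → Fin n} :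
    Contains3 n ![3, 2, 1] π ↔ ∃ i j k, i < j ∧ j < k ∧ π k < π j ∧ π j < π i := by
  simp only [contains3_iff, Fin.forall_fin_succ, Fin.lt_def]
  simp
  grind

theorem avoids3_312_and_321_iff {n : ℕ} {π : Fin (2 * n) → Fin n} :
    Avoids3 n ![3, 1, 2] π ∧ Avoids3 n ![3, 2, 1] π ↔
      ∀ a b c, a < c → b < c → a ≠ b → ¬ [a, b, c].Sublist (reverseWord π) := by
  simp only [Avoids3, contains3_312_iff, contains3_321_iff, three_sublist_reverseWord_iff]
  constructor
  · rintro ⟨h₁, h₂⟩ _ _ _ hac hbc hab ⟨i, j, k, hij, hjk, rfl, rfl, rfl⟩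
    rcases hab.lt_or_gt with h | h
    · exact h₂ ⟨i, j, k, hij, hjk, h, hbc⟩
    · exact h₁ ⟨i, j, k, hij, hjk, h, hac⟩
  · intro h
    constructor
    · rintro ⟨i, j, k, hij, hjk, h₁, h₂⟩
      exact h _ _ _ h₂ (h₁.trans h₂) (Fin.val_ne_of_ne h₁.ne') ⟨i, j, k, hij, hjk, rfl, rfl, rfl⟩
    · rintro ⟨i, j, k, hij, hjk, h₁, h₂⟩
      exact h _ _ _ (h₁.trans h₂) h₂ (Fin.val_ne_of_ne h₁.ne) ⟨i, j, k, hij, hjk, rfl, rfl, rfl⟩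

theorem avoids1212_and_2121_iff {n : ℕ} {π : Fin (2 * n) → Fin n} :
    Avoids1212 n π ∧ Avoids2121 n π ↔
      ∀ a b, a ≠ b → ¬ [a, b, a, b].Sublist (reverseWord π) := by
  simp only [Avoids1212, Avoids2121, four_sublist_reverseWord_iff]
  constructor
  · rintro ⟨h₁, h₂⟩ _ _ hab ⟨i, j, k, l, hij, hjk, hkl, hi, hj, rfl, rfl⟩
    rcases hab.lt_or_gt with h | h
    · exact h₂ ⟨i, j, k, l, hij, hjk, hkl, Fin.ext hi, Fin.ext hj, by rw [Fin.lt_def]; omega⟩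
    · exact h₁ ⟨i, j, k, l, hij, hjk, hkl, Fin.ext hi, Fin.ext hj, by rw [Fin.lt_def]; omega⟩
  · intro h
    constructor
    · rintro ⟨i, j, k, l, hij, hjk, hkl, hi, hj, hlt⟩
      exact h (π j) (π i) (Fin.val_ne_of_ne hlt.ne')
        ⟨i, j, k, l, hij, hjk, hkl, rfl, rfl, by rw [hi], by rw [hj]⟩
    · rintro ⟨i, j, k, l, hij, hjk, hkl, hi, hj, hlt⟩
      exact h (π j) (π i) (Fin.val_ne_of_ne hlt.ne)
        ⟨i, j, k, l, hij, hjk, hkl, rfl, rfl, by rw [hi], by rw [hj]⟩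

theorem isMultisetPerm_iff {n : ℕ} {π : Fin (2 * n) → Fin n} :
    IsMultisetPerm n π ↔ ∀ v < n, (reverseWord π).count v = 2 := by
  simp only [IsMultisetPerm, reverseWord, List.count_reverse, count_ofFn,
    Fin.forall_iff, Fin.ext_iff]

theorem goodWord_reverseWord_iff {n : ℕ} {π : Fin (2 * n) → Fin n} :
    GoodWord n (reverseWord π) ↔
      IsQuasiStirling n π ∧ Avoids3 n ![3, 1, 2] π ∧ Avoids3 n ![3, 2, 1] π := by
  rw [avoids3_312_and_321_iff, IsQuasiStirling, avoids1212_and_2121_iff, isMultisetPerm_iff]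
  constructor
  · exact fun h => ⟨⟨h.count_eq, h.noncrossing⟩, h.layered⟩
  · rintro ⟨⟨h₁, h₂⟩, h₃⟩
    exact ⟨by simp [reverseWord], by simp [reverseWord], h₁, h₂, h₃⟩

theorem GoodWord.exists_reverseWord_eq {n : ℕ} {w : List ℕ} (hw : GoodWord n w) :
    ∃ π : Fin (2 * n) → Fin n, reverseWord π = w := by
  have hl : w.reverse.length = 2 * n := by rw [List.length_reverse, hw.length_eq]
  refine ⟨fun i => ⟨w.reverse.get (i.cast hl.symm),
    hw.lt _ (List.mem_reverse.1 (List.get_mem _ _))⟩, ?_⟩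
  rw [reverseWord, List.reverse_eq_iff]
  apply List.ext_get <;> simp [hw.length_eq]

theorem quasiStirling_avoiding_312_321 (n : ℕ) (hn : 2 ≤ n) :
    Nat.card {π : Fin (2 * n) → Fin n //
      IsQuasiStirling n π ∧ Avoids3 n ![3, 1, 2] π ∧ Avoids3 n ![3, 2, 1] π} =
      4 * 3 ^ (n - 2) := by
  have h : reverseWord '' {π : Fin (2 * n) → Fin n |
      IsQuasiStirling n π ∧ Avoids3 n ![3, 1, 2] π ∧ Avoids3 n ![3, 2, 1] π} =
      {w | GoodWord n w} := by
    ext w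
    constructor
    · rintro ⟨π, hπ, rfl⟩
      exact goodWord_reverseWord_iff.2 hπ
    · intro hw
      obtain ⟨π, rfl⟩ := GoodWord.exists_reverseWord_eq hw
      exact ⟨π, goodWord_reverseWord_iff.1 hw, rfl⟩
  obtain ⟨m, rfl⟩ := Nat.exists_eq_add_of_le' hn
  rw [← Set.coe_ofPred, Nat.card_coe_set_eq,
    ← Set.ncard_image_of_injective _ (reverseWord_injective _), h, Set.ncard,
    encard_goodWord_add_two, Nat.add_sub_cancel]
  exact_mod_cast ENat.toNat_natCast (4 * 3 ^ m)
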